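/- Let A ⊆ ℝⁿ be a bounded Borel set, let f : A → ℝᵐ be a Lipschitz map, and let F : ℝⁿ → ℝᵐ be any Lipschitz map with F|_A = f. For r > 0 and x ∈ A define the Korevaar–Schoen energy density at scale r by ks_r(f)(x) := ( (1/ℒⁿ(B_r(x))) ∫_{B_r(x) ∩ A} ‖f(x) − f(y)‖²/r² dℒⁿ(y) )^{1/2}. Then (n+2)·ks_r(f)² converges to ‖DF‖_HS² in L¹(A, ℒⁿ) as r → 0⁺; in particular lim_{r→0⁺} ∫_A ks_r(f)(x)² dℒⁿ(x) = (1/(n+2)) ∫_A ‖DF(x)‖_HS² dℒⁿ(x). -/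

import Mathlib

open Metric MeasureTheory Filter Topology
open scoped NNReal

theorem ks_normsq (n : ℕ) {r : ℝ} (hr : 0 < r) :
    ∫ y in ball (0 : EuclideanSpace ℝ (Fin n)) r, ‖y‖ ^ 2 =
      n / ((n : ℝ) + 2) * r ^ 2 * volume.real (ball (0 : EuclideanSpace ℝ (Fin n)) r) := by
  rcases Nat.eq_zero_or_pos n with h0 | hn
  · subst h0
    have : ∀ y : EuclideanSpace ℝ (Fin 0), ‖y‖ ^ 2 = 0 := fun y => by
      rw [Subsingleton.elim y 0]; simp
    simp [this]
  have : Nonempty (Fin n) := ⟨⟨0, hn⟩⟩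
  have : Nontrivial (EuclideanSpace ℝ (Fin n)) := inferInstance
  have h1 : ∫ y in ball (0 : EuclideanSpace ℝ (Fin n)) r, ‖y‖ ^ 2 =
      ∫ y : EuclideanSpace ℝ (Fin n), (Set.Iio r).indicator (fun t => t ^ 2) ‖y‖ := by
    rw [← integral_indicator measurableSet_ball]
    congr 1; ext y
    simp [Set.indicator]
  have h2 : volume.real (ball (0 : EuclideanSpace ℝ (Fin n)) r) =
      r ^ n * volume.real (ball (0 : EuclideanSpace ℝ (Fin n)) 1) := by
    rw [measureReal_def, Measure.addHaar_ball_of_pos _ _ hr, ENNReal.toReal_mul,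
      ENNReal.toReal_ofReal (by positivity)]
    simp [measureReal_def]
  have h3 : ∫ t in Set.Ioi (0 : ℝ), t ^ (n - 1) • (Set.Iio r).indicator (fun t => t ^ 2) t =
      r ^ (n + 2) / ((n : ℝ) + 2) := by
    have : ∀ t : ℝ, t ^ (n - 1) • (Set.Iio r).indicator (fun t => t ^ 2) t =
        (Set.Iio r).indicator (fun t => t ^ (n + 1)) t := by
      intro t
      by_cases h : t ∈ Set.Iio r
      · simp only [Set.indicator_of_mem h, smul_eq_mul, ← pow_add]
        congr 1; omega
      · simp [Set.indicator_of_notMem h]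
    simp_rw [this]
    rw [setIntegral_indicator measurableSet_Iio, Set.Ioi_inter_Iio, ← integral_Ioc_eq_integral_Ioo,
      ← intervalIntegral.integral_of_le hr.le, integral_pow]
    push_cast
    simp
    ring
  rw [h1, integral_fun_norm_addHaar, finrank_euclideanSpace_fin, h3, h2]
  simp only [nsmul_eq_mul, smul_eq_mul]
  ring

theorem ks_offdiag (n : ℕ) (r : ℝ) (i j : Fin n) (hij : i ≠ j) :
    ∫ y in ball (0 : EuclideanSpace ℝ (Fin n)) r, y i * y j = 0 := by
  let e : EuclideanSpace ℝ (Fin n) ≃ₗᵢ[ℝ] EuclideanSpace ℝ (Fin n) :=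
    LinearIsometryEquiv.piLpCongrRight 2
      (fun k => if k = i then LinearIsometryEquiv.neg ℝ else LinearIsometryEquiv.refl ℝ ℝ)
  have h := e.measurePreserving.setIntegral_preimage_emb
    e.toHomeomorph.measurableEmbedding
    (fun y : EuclideanSpace ℝ (Fin n) => y i * y j) (ball 0 r)
  have hp : e ⁻¹' (ball 0 r) = ball 0 r := by ext y; simp
  rw [hp] at h
  have h2 : ∀ y : EuclideanSpace ℝ (Fin n), e y i * e y j = - (y i * y j) := by
    intro y
    simp [e, hij.symm]
  simp_rw [h2, integral_neg] at h
  linarith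

theorem ks_diag_eq (n : ℕ) (r : ℝ) (i j : Fin n) :
    ∫ y in ball (0 : EuclideanSpace ℝ (Fin n)) r, (y i) ^ 2 =
    ∫ y in ball (0 : EuclideanSpace ℝ (Fin n)) r, (y j) ^ 2 := by
  let e : EuclideanSpace ℝ (Fin n) ≃ₗᵢ[ℝ] EuclideanSpace ℝ (Fin n) :=
    LinearIsometryEquiv.piLpCongrLeft 2 ℝ ℝ (Equiv.swap i j)
  have h := e.measurePreserving.setIntegral_preimage_emb
    e.toHomeomorph.measurableEmbedding
    (fun y : EuclideanSpace ℝ (Fin n) => (y j) ^ 2) (ball 0 r)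
  have hp : e ⁻¹' (ball 0 r) = ball 0 r := by ext y; simp
  rw [hp] at h
  have h2 : ∀ y : EuclideanSpace ℝ (Fin n), e y j = y i := by
    intro y
    simp [e, LinearIsometryEquiv.piLpCongrLeft_apply]
  simp_rw [h2] at h
  exact h

theorem ks_intOn {n : ℕ} (x : EuclideanSpace ℝ (Fin n)) (r : ℝ)
    {g : EuclideanSpace ℝ (Fin n) → ℝ} (hg : Continuous g) : IntegrableOn g (ball x r) :=
  (hg.continuousOn.integrableOn_compact (isCompact_closedBall x r)).mono_set ball_subset_closedBall

theorem ks_diag (n : ℕ) {r : ℝ} (hr : 0 < r) (i : Fin n) :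
    ∫ y in ball (0 : EuclideanSpace ℝ (Fin n)) r, (y i) ^ 2 =
      1 / ((n : ℝ) + 2) * r ^ 2 * volume.real (ball (0 : EuclideanSpace ℝ (Fin n)) r) := by
  have h := ks_normsq n hr
  simp_rw [EuclideanSpace.real_norm_sq_eq] at h
  rw [integral_finsetSum _ (fun k _ => ks_intOn _ _ (by fun_prop)),
    Finset.sum_congr rfl (fun k _ => ks_diag_eq n r k i)] at h
  simp only [Finset.sum_const, Finset.card_univ, Fintype.card_fin, nsmul_eq_mul] at h
  have hn : (n : ℝ) ≠ 0 := by
    have := i.pos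
    positivity
  apply mul_left_cancel₀ hn
  rw [h]; ring

theorem ks_quad {n m : ℕ} (L : EuclideanSpace ℝ (Fin n) →L[ℝ] EuclideanSpace ℝ (Fin m))
    {r : ℝ} (hr : 0 < r) :
    ∫ y in ball (0 : EuclideanSpace ℝ (Fin n)) r, ‖L y‖ ^ 2 =
      1 / ((n : ℝ) + 2) * r ^ 2 * volume.real (ball (0 : EuclideanSpace ℝ (Fin n)) r) *
        ∑ i : Fin n, ‖L (EuclideanSpace.single i 1)‖ ^ 2 := by
  have hL : ∀ y : EuclideanSpace ℝ (Fin n), ‖L y‖ ^ 2 =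
      ∑ i, ∑ j, (y i * y j) *
        inner ℝ (L (EuclideanSpace.single i 1)) (L (EuclideanSpace.single j 1)) := by
    intro y
    have hy : L y = ∑ i, y i • L (EuclideanSpace.single i 1) := by
      conv_lhs => rw [← (EuclideanSpace.basisFun (Fin n) ℝ).sum_repr y]
      simp
    rw [← real_inner_self_eq_norm_sq, hy, sum_inner]
    refine Finset.sum_congr rfl fun i _ => ?_
    rw [inner_sum]
    refine Finset.sum_congr rfl fun j _ => ?_
    rw [real_inner_smul_left, real_inner_smul_right]; ring
  rw [integral_congr_ae (Eventually.of_forall hL)]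
  rw [integral_finsetSum _ (fun k _ => ks_intOn _ _ (by fun_prop)), Finset.mul_sum]
  refine Finset.sum_congr rfl fun i _ => ?_
  rw [integral_finsetSum _ (fun k _ => ks_intOn _ _ (by fun_prop))]
  rw [Finset.sum_eq_single i]
  · rw [integral_mul_const, real_inner_self_eq_norm_sq, ← ks_diag n hr i]
    simp_rw [pow_two (_ : ℝ)]
  · intro j _ hj
    rw [integral_mul_const, ks_offdiag n r i j hj.symm, zero_mul]
  · simp

theorem ks_quad' {n m : ℕ} (L : EuclideanSpace ℝ (Fin n) →L[ℝ] EuclideanSpace ℝ (Fin m))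
    (x : EuclideanSpace ℝ (Fin n)) {r : ℝ} (hr : 0 < r) :
    ∫ y in ball x r, ‖L (y - x)‖ ^ 2 =
      1 / ((n : ℝ) + 2) * r ^ 2 * volume.real (ball x r) *
        ∑ i : Fin n, ‖L (EuclideanSpace.single i 1)‖ ^ 2 := by
  rw [Measure.addHaar_real_ball_center, ← ks_quad L hr]
  have h := (measurePreserving_sub_right volume x).setIntegral_preimage_emb
    (Homeomorph.subRight x).measurableEmbedding
    (fun y : EuclideanSpace ℝ (Fin n) => ‖L y‖ ^ 2) (ball 0 r)
  rw [← h]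
  congr 2
  ext y; simp [dist_eq_norm]

/-- The squared density. -/
noncomputable def ksG {n m : ℕ} (A : Set (EuclideanSpace ℝ (Fin n)))
    (F : EuclideanSpace ℝ (Fin n) → EuclideanSpace ℝ (Fin m)) (r : ℝ)
    (x : EuclideanSpace ℝ (Fin n)) : ℝ :=
  (volume (Metric.ball x r)).toReal⁻¹ *
              ∫ y in Metric.ball x r ∩ A, ‖F x - F y‖ ^ 2 / r ^ 2 ∂volume

theorem ks_vol_pos {n : ℕ} (x : EuclideanSpace ℝ (Fin n)) {r : ℝ} (hr : 0 < r) :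
    0 < volume.real (ball x r) :=
  ENNReal.toReal_pos (measure_ball_pos _ _ hr).ne' measure_ball_lt_top.ne

theorem ksG_bound {n m : ℕ} (A : Set (EuclideanSpace ℝ (Fin n)))
    (K : ℝ≥0) (F : EuclideanSpace ℝ (Fin n) → EuclideanSpace ℝ (Fin m))
    (hF : LipschitzWith K F) {r : ℝ} (hr : 0 < r) (x : EuclideanSpace ℝ (Fin n)) :
    ‖ksG A F r x‖ ≤ K ^ 2 := by
  have hV := ks_vol_pos x hr
  have h1 : ‖∫ y in ball x r ∩ A, ‖F x - F y‖ ^ 2 / r ^ 2‖ ≤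
      K ^ 2 * volume.real (ball x r ∩ A) := by
    apply norm_setIntegral_le_of_norm_le_const
      ((measure_mono Set.inter_subset_left).trans_lt measure_ball_lt_top)
    intro y hy
    have hy1 : ‖x - y‖ < r := by
      have := hy.1
      rwa [mem_ball, dist_comm, dist_eq_norm] at this
    have h2 : ‖F x - F y‖ ≤ K * r :=
      (hF.norm_sub_le x y).trans (by gcongr)
    rw [Real.norm_of_nonneg (by positivity), div_le_iff₀ (by positivity), ← mul_pow]
    gcongr
  have h2 : volume.real (ball x r ∩ A) ≤ volume.real (ball x r) :=
    measureReal_mono Set.inter_subset_left measure_ball_lt_top.ne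
  rw [ksG, norm_mul, norm_inv, ← measureReal_def, Real.norm_of_nonneg hV.le,
    inv_mul_le_iff₀ hV]
  calc _ ≤ _ := h1
    _ ≤ K ^ 2 * volume.real (ball x r) := by gcongr
    _ = _ := by ring

theorem ksG_meas {n m : ℕ} (A : Set (EuclideanSpace ℝ (Fin n))) (hA : MeasurableSet A)
    (F : EuclideanSpace ℝ (Fin n) → EuclideanSpace ℝ (Fin m))
    (hF : Continuous F) (r : ℝ) : StronglyMeasurable (ksG A F r) := by
  have h1 : ∀ x, ksG A F r x = (volume (ball (0 : EuclideanSpace ℝ (Fin n)) r)).toReal⁻¹ *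
      ∫ y, ({p : EuclideanSpace ℝ (Fin n) × EuclideanSpace ℝ (Fin n) |
        dist p.2 p.1 < r} ∩ Prod.snd ⁻¹' A).indicator
        (fun p => ‖F p.1 - F p.2‖ ^ 2 / r ^ 2) (x, y) := by
    intro x
    rw [ksG, Measure.addHaar_ball_center, ← integral_indicator (measurableSet_ball.inter hA)]
    rfl
  rw [funext h1]
  apply StronglyMeasurable.const_mul
  apply StronglyMeasurable.integral_prod_right'
  apply StronglyMeasurable.indicator
  · apply Continuous.stronglyMeasurable
    fun_prop
  · apply MeasurableSet.inter
    · exact (isOpen_lt (by fun_prop) continuous_const).measurableSet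
    · exact measurable_snd hA

theorem ksG_lim {n m : ℕ} (A : Set (EuclideanSpace ℝ (Fin n))) (hA : MeasurableSet A)
    (K : ℝ≥0) (F : EuclideanSpace ℝ (Fin n) → EuclideanSpace ℝ (Fin m))
    (hF : LipschitzWith K F) (x : EuclideanSpace ℝ (Fin n)) (hd : DifferentiableAt ℝ F x)
    (hx : Tendsto (fun r => volume (Aᶜ ∩ closedBall x r) / volume (closedBall x r)) (𝓝[>] 0)
      (𝓝 0)) :
    Tendsto (fun r => ksG A F r x) (𝓝[>] 0) (𝓝 (1 / ((n : ℝ) + 2) *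
      ∑ i : Fin n, ‖fderiv ℝ F x (EuclideanSpace.single i 1)‖ ^ 2)) := by
  set L := fderiv ℝ F x with hLdef
  have hLK : ‖L‖ ≤ K := norm_fderiv_le_of_lipschitz ℝ hF
  rw [Metric.tendsto_nhds]
  intro ε hε
  set δ : ℝ := ε / (2 * K + K ^ 2 + 1) with hδdef
  have hK : (0 : ℝ) ≤ K := K.coe_nonneg
  have hδ : 0 < δ := by positivity
  have hden : ∀ᶠ r in 𝓝[>] (0 : ℝ),
      volume (Aᶜ ∩ closedBall x r) / volume (closedBall x r) < ENNReal.ofReal δ :=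
    hx.eventually_lt_const (by simpa using hδ)
  have hdiff := hd.hasFDerivAt.isLittleO.def hδ
  rw [Metric.eventually_nhds_iff] at hdiff
  obtain ⟨ρ, hρ, hdiff⟩ := hdiff
  filter_upwards [hden, self_mem_nhdsWithin, nhdsWithin_le_nhds (Iio_mem_nhds hρ)]
    with r hr1 hr hrρ
  replace hr : 0 < r := hr
  replace hrρ : r < ρ := hrρ
  have hV := ks_vol_pos x hr
  set V := volume.real (ball x r) with hVdef
  have hcV : volume (closedBall x r) = volume (ball x r) := by
    rw [Measure.addHaar_ball_of_pos _ _ hr, Measure.addHaar_closedBall _ _ hr.le]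
  have hbad : volume.real (ball x r \ A) ≤ δ * V := by
    rw [hcV] at hr1
    have h1 : volume (ball x r \ A) ≤ volume (Aᶜ ∩ closedBall x r) :=
      measure_mono fun y hy => ⟨hy.2, ball_subset_closedBall hy.1⟩
    have h2 := (ENNReal.div_le_iff (measure_ball_pos volume x hr).ne' measure_ball_lt_top.ne).1
      hr1.le
    have h3 := ENNReal.toReal_mono
      (ENNReal.mul_ne_top ENNReal.ofReal_ne_top measure_ball_lt_top.ne) (h1.trans h2)
    rwa [ENNReal.toReal_mul, ENNReal.toReal_ofReal hδ.le] at h3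
  have hi1 : IntegrableOn (fun y => ‖F x - F y‖ ^ 2) (ball x r) := by
    have := hF.continuous
    exact ks_intOn _ _ (by fun_prop)
  have hi2 : IntegrableOn (fun y => ‖L (y - x)‖ ^ 2) (ball x r) :=
    ks_intOn _ _ (by fun_prop)
  have hq := ks_quad' L x hr
  have hsplit := integral_inter_add_sdiff hA hi2
  have hE1 : ‖∫ y in ball x r ∩ A, (‖F x - F y‖ ^ 2 - ‖L (y - x)‖ ^ 2)‖ ≤
      (δ * r * (2 * K * r)) * volume.real (ball x r ∩ A) := by
    apply norm_setIntegral_le_of_norm_le_const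
      ((measure_mono Set.inter_subset_left).trans_lt measure_ball_lt_top)
    intro y hy
    have hy0 : ‖y - x‖ < r := by
      have := hy.1
      rwa [mem_ball, dist_eq_norm] at this
    have a1 : ‖F y - F x‖ ≤ K * r := (hF.norm_sub_le y x).trans (by gcongr)
    have a2 : ‖L (y - x)‖ ≤ K * r := (L.le_opNorm _).trans (by gcongr)
    have a3 : ‖F y - F x - L (y - x)‖ ≤ δ * r :=
      (hdiff (y := y) (by rw [dist_eq_norm]; linarith)).trans (by gcongr)
    have a4 := (abs_norm_sub_norm_le (F y - F x) (L (y - x))).trans a3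
    rw [norm_sub_rev (F x), Real.norm_eq_abs, sq_sub_sq, abs_mul, mul_comm (δ * r)]
    rw [abs_of_nonneg (by positivity : 0 ≤ ‖F y - F x‖ + ‖L (y - x)‖)]
    gcongr
    linarith
  have hE2 : ‖∫ y in ball x r \ A, ‖L (y - x)‖ ^ 2‖ ≤ (K * r) ^ 2 * volume.real (ball x r \ A) := by
    apply norm_setIntegral_le_of_norm_le_const
      ((measure_mono Set.sdiff_subset).trans_lt measure_ball_lt_top)
    intro y hy
    have hy0 : ‖y - x‖ < r := by
      have := hy.1
      rwa [mem_ball, dist_eq_norm] at this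
    have a2 : ‖L (y - x)‖ ≤ K * r := (L.le_opNorm _).trans (by gcongr)
    rw [Real.norm_of_nonneg (by positivity)]
    gcongr
  rw [integral_sub (hi1.mono_set Set.inter_subset_left)
    (hi2.mono_set Set.inter_subset_left)] at hE1
  have hgood : volume.real (ball x r ∩ A) ≤ V :=
    measureReal_mono Set.inter_subset_left measure_ball_lt_top.ne
  have hE1' := hE1.trans (mul_le_mul_of_nonneg_left hgood (by positivity))
  have hE2' := hE2.trans (mul_le_mul_of_nonneg_left hbad (by positivity))
  rw [ksG, ← measureReal_def, integral_div, Real.dist_eq]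
  set S := ∑ i : Fin n, ‖L (EuclideanSpace.single i 1)‖ ^ 2
  set I := ∫ y in ball x r ∩ A, ‖F x - F y‖ ^ 2
  set J := ∫ y in ball x r ∩ A, ‖L (y - x)‖ ^ 2
  set J' := ∫ y in ball x r \ A, ‖L (y - x)‖ ^ 2
  have key : V⁻¹ * (I / r ^ 2) - 1 / ((n : ℝ) + 2) * S = ((I - J) - J') / (V * r ^ 2) := by
    have : 1 / ((n : ℝ) + 2) * S = (J + J') / (V * r ^ 2) := by
      rw [hsplit, hq, ← hVdef]; field_simp
    rw [this]; field_simp; ring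
  rw [key, abs_div, abs_of_pos (by positivity : 0 < V * r ^ 2), div_lt_iff₀ (by positivity)]
  have hfin : |I - J - J'| ≤ δ * (2 * K + K ^ 2) * (V * r ^ 2) := by
    refine (abs_sub _ _).trans ?_
    rw [Real.norm_eq_abs] at hE1' hE2'
    nlinarith
  refine hfin.trans_lt ?_
  gcongr
  rw [hδdef, div_mul_eq_mul_div, div_lt_iff₀ (by positivity)]
  nlinarith

/-- Let `A ⊆ ℝⁿ` be a bounded Borel set, `f : A → ℝᵐ` Lipschitz, and `F : ℝⁿ → ℝᵐ` any
Lipschitz map with `F|_A = f`. With the Korevaar–Schoen density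
`ks_r(f)(x)² = (1/ℒⁿ(B_r(x))) ∫_{B_r(x) ∩ A} ‖f(x) − f(y)‖²/r² dℒⁿ(y)`, the functions
`(n+2)·ks_r(f)²` converge to `‖DF‖_HS²` in `L¹(A, ℒⁿ)` as `r → 0⁺`; in particular
`lim_{r→0⁺} ∫_A ks_r(f)² = (1/(n+2)) ∫_A ‖DF‖_HS²`. -/
theorem stmt9 (n m : ℕ) (A : Set (EuclideanSpace ℝ (Fin n)))
    (hA : MeasurableSet A) (hAb : Bornology.IsBounded A)
    (K : ℝ≥0) (F : EuclideanSpace ℝ (Fin n) → EuclideanSpace ℝ (Fin m))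
    (hF : LipschitzWith K F) :
    Tendsto (fun r : ℝ => ∫ x in A,
        |((n : ℝ) + 2) *
            ((volume (Metric.ball x r)).toReal⁻¹ *
              ∫ y in Metric.ball x r ∩ A, ‖F x - F y‖ ^ 2 / r ^ 2 ∂volume) -
          ∑ i : Fin n, ‖fderiv ℝ F x (EuclideanSpace.single i 1)‖ ^ 2| ∂volume)
      (𝓝[>] 0) (𝓝 0) ∧
    Tendsto (fun r : ℝ => ∫ x in A,
        ((volume (Metric.ball x r)).toReal⁻¹ *
          ∫ y in Metric.ball x r ∩ A, ‖F x - F y‖ ^ 2 / r ^ 2 ∂volume) ∂volume)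
      (𝓝[>] 0)
      (𝓝 ((1 / ((n : ℝ) + 2)) *
        ∫ x in A, ∑ i : Fin n, ‖fderiv ℝ F x (EuclideanSpace.single i 1)‖ ^ 2 ∂volume)) := by
  have : IsFiniteMeasure (volume.restrict A) :=
    ⟨by rw [Measure.restrict_apply_univ]; exact hAb.measure_lt_top⟩
  have hlim : ∀ᵐ x ∂(volume.restrict A), Tendsto (fun r => ksG A F r x) (𝓝[>] 0)
      (𝓝 (1 / ((n : ℝ) + 2) *
        ∑ i : Fin n, ‖fderiv ℝ F x (EuclideanSpace.single i 1)‖ ^ 2)) := by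
    rw [ae_restrict_iff' hA]
    filter_upwards [hF.ae_differentiableAt (μ := volume),
      Besicovitch.ae_tendsto_measure_inter_div_of_measurableSet volume hA.compl] with x h1 h2 hxA
    refine ksG_lim A hA K F hF x h1 ?_
    simpa [hxA] using h2
  have hHmeas : Measurable fun x : EuclideanSpace ℝ (Fin n) =>
      ∑ i : Fin n, ‖fderiv ℝ F x (EuclideanSpace.single i 1)‖ ^ 2 :=
    Finset.measurable_fun_sum _ fun i _ => (measurable_fderiv_apply_const ℝ F _).norm.pow_const 2
  have hHbd : ∀ x : EuclideanSpace ℝ (Fin n),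
      |∑ i : Fin n, ‖fderiv ℝ F x (EuclideanSpace.single i 1)‖ ^ 2| ≤ n * (K : ℝ) ^ 2 := by
    intro x
    rw [abs_of_nonneg (by positivity)]
    calc _ ≤ ∑ i : Fin n, (K : ℝ) ^ 2 := by
          gcongr with i
          refine (ContinuousLinearMap.le_opNorm _ _).trans ?_
          simpa using norm_fderiv_le_of_lipschitz ℝ hF
      _ = _ := by simp
  have hpos : (0 : ℝ) < (n : ℝ) + 2 := by positivity
  constructor
  · have := tendsto_integral_filter_of_dominated_convergence (μ := volume.restrict A)
      (l := 𝓝[>] (0 : ℝ))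
      (F := fun r x => |((n : ℝ) + 2) * ksG A F r x -
          ∑ i : Fin n, ‖fderiv ℝ F x (EuclideanSpace.single i 1)‖ ^ 2|)
      (f := fun _ => 0) (fun _ => ((n : ℝ) + 2) * (K : ℝ) ^ 2 + n * (K : ℝ) ^ 2)
      ?_ ?_ (integrable_const _) ?_
    · simpa [ksG] using this
    · refine Eventually.of_forall fun r => ?_
      exact (((ksG_meas A hA F hF.continuous r).measurable.const_mul _).sub
        hHmeas).norm.aestronglyMeasurable
    · filter_upwards [self_mem_nhdsWithin] with r hr
      refine Eventually.of_forall fun x => ?_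
      have h1 := ksG_bound A K F hF hr x
      rw [Real.norm_eq_abs, abs_abs]
      refine (abs_sub _ _).trans (add_le_add ?_ (hHbd x))
      rw [abs_mul, abs_of_pos hpos]
      gcongr
      exact h1
    · filter_upwards [hlim] with x hx
      have h1 := ((hx.const_mul ((n : ℝ) + 2)).sub_const
        (∑ i : Fin n, ‖fderiv ℝ F x (EuclideanSpace.single i 1)‖ ^ 2)).abs
      convert h1 using 2
      rw [← mul_assoc, mul_one_div_cancel hpos.ne']
      simp
  · rw [← integral_const_mul]
    exact tendsto_integral_filter_of_dominated_convergence (μ := volume.restrict A)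
      (F := fun r x => ksG A F r x) (fun _ => (K : ℝ) ^ 2)
      (Eventually.of_forall fun r => (ksG_meas A hA F hF.continuous r).aestronglyMeasurable)
      (by
        filter_upwards [self_mem_nhdsWithin] with r hr
        exact Eventually.of_forall fun x => ksG_bound A K F hF hr x)
      (integrable_const _) hlim
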